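/- Let (A_s)_{s∈S} be a family of closed subsets of the simplex Δ(S) such that for every nonempty subset N ⊆ S, the convex hull of {e^s : s ∈ N} is contained in ⋃_{s∈N} A_s. Then ⋂_{s∈S} A_s ≠ ∅. -/

import Mathlib

open Finset

/-- The probability simplex `Δ(S)` inside `ℝ^S`. -/
def simplex (S : Type*) [Fintype S] : Set (S → ℝ) :=
  {p | (∀ s, 0 ≤ p s) ∧ ∑ s, p s = 1}

/-- The vertex `e^s` of the simplex: point mass at `s`. -/
def pointMass {S : Type*} [DecidableEq S] (s : S) : S → ℝ :=
  fun j => if j = s then 1 else 0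

/-- For a family of rankings `r`, a finset `V` is dominant if no point is ranked strictly above
the minimum of `V` in every ranking. -/
def IsDominant {I X α : Type*} [LinearOrder α] (r : I → X → α) (V : Finset X) : Prop :=
  ∀ y, ∃ i, ∀ x ∈ V, r i y ≤ r i x

section Dominant

variable {I X α : Type*} [LinearOrder α] {r : I → X → α} {V : Finset X} {m : I → X}

/-- `y` is the point ranked highest by `r j` among those lying above `m` in all other rankings. -/
def IsReplacement (r : I → X → α) (m : I → X) (j : I) (y : X) : Prop :=
  (∀ i, i ≠ j → r i (m i) < r i y) ∧
    ∀ z, (∀ i, i ≠ j → r i (m i) < r i z) → r j z ≤ r j y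

theorem IsReplacement.unique (hr : ∀ i, Function.Injective (r i)) {j : I} {y z : X}
    (hy : IsReplacement r m j y) (hz : IsReplacement r m j z) : y = z :=
  hr j (le_antisymm (hz.2 y hy.1) (hy.2 z hz.1))

theorem exists_isReplacement [Fintype X] {j : I} {y : X}
    (hy : ∀ i, i ≠ j → r i (m i) < r i y) : ∃ z, IsReplacement r m j z := by
  classical
  obtain ⟨z, hz, hmax⟩ := (univ.filter fun z => ∀ i, i ≠ j → r i (m i) < r i z).exists_max_image
    (r j) ⟨y, by simpa using hy⟩
  exact ⟨z, by simpa using hz, fun w hw => hmax w (by simpa using hw)⟩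

theorem IsDominant.exists_argmin_eq (hr : ∀ i, Function.Injective (r i)) (hV : IsDominant r V)
    (hmV : ∀ i, m i ∈ V) (hm : ∀ i, ∀ x ∈ V, r i (m i) ≤ r i x) {x : X} (hx : x ∈ V) :
    ∃ i, m i = x := by
  obtain ⟨i, hi⟩ := hV x
  exact ⟨i, hr i (le_antisymm (hm i x hx) (hi _ (hmV i)))⟩

/-- A map onto `V` from the indices other than `j` is injective when `V` has one point less than
the index set. -/
theorem eq_of_surjOn_erase [Fintype I] (hcard : #V + 1 = Fintype.card I) {j : I}
    (hsurj : ∀ x ∈ V, ∃ i, i ≠ j ∧ m i = x) (hmV : ∀ i, m i ∈ V) {a b : I} (ha : a ≠ j)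
    (hb : b ≠ j) (hab : m a = m b) : a = b := by
  classical
  have himg : (univ.erase j).image m = V := by
    ext x
    simp only [mem_image, mem_erase, mem_univ, and_true]
    exact ⟨fun ⟨i, _, h⟩ => h ▸ hmV i, hsurj x⟩
  have hinj : Set.InjOn m (univ.erase j : Finset I) := by
    rw [← card_image_iff, himg, card_erase_of_mem (mem_univ j), card_univ]
    omega
  exact hinj (by simpa using ha) (by simpa using hb) hab

theorem IsReplacement.notMem (hr : ∀ i, Function.Injective (r i)) (hV : IsDominant r V)
    (hmV : ∀ i, m i ∈ V) (hm : ∀ i, ∀ x ∈ V, r i (m i) ≤ r i x) {j k : I} (hjk : j ≠ k)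
    (hmjk : m j = m k) {y : X} (hy : IsReplacement r m j y) : y ∉ V := by
  intro hyV
  obtain ⟨i, rfl⟩ := hV.exists_argmin_eq hr hmV hm hyV
  by_cases hij : i = j
  · subst hij
    have := hy.1 k hjk.symm
    rw [hmjk] at this
    exact lt_irrefl _ this
  · exact lt_irrefl _ (hy.1 i hij)

theorem IsReplacement.isDominant_insert [DecidableEq X] (hV : IsDominant r V)
    (hmV : ∀ i, m i ∈ V) (hm : ∀ i, ∀ x ∈ V, r i (m i) ≤ r i x) {j : I} {y : X}
    (hy : IsReplacement r m j y) : IsDominant r (insert y V) := by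
  intro z
  by_cases hz : ∀ i, i ≠ j → r i (m i) < r i z
  · refine ⟨j, fun x hx => ?_⟩
    obtain rfl | hx := mem_insert.1 hx
    · exact hy.2 z hz
    · obtain ⟨i, hi⟩ := hV y
      obtain rfl : i = j := by
        by_contra hij
        exact (hy.1 i hij).not_ge (hi _ (hmV i))
      exact (hy.2 z hz).trans (hi x hx)
  · push Not at hz
    obtain ⟨i, hij, hi⟩ := hz
    refine ⟨i, fun x hx => ?_⟩
    obtain rfl | hx := mem_insert.1 hx
    · exact hi.trans (hy.1 i hij).le
    · exact hi.trans (hm i x hx)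

theorem IsDominant.isReplacement_of_insert [Fintype I] [DecidableEq X]
    (hr : ∀ i, Function.Injective (r i)) (hcard : #V + 1 = Fintype.card I)
    (hmV : ∀ i, m i ∈ V) (hm : ∀ i, ∀ x ∈ V, r i (m i) ≤ r i x) {a b : I} (hab : a ≠ b)
    (hmab : m a = m b) {y : X} (hyV : y ∉ V) (hy : IsDominant r (insert y V)) :
    IsReplacement r m a y ∨ IsReplacement r m b y := by
  obtain ⟨j, hj⟩ := hy y
  have hbelow : ∀ x ∈ V, ∃ i, i ≠ j ∧ m i = x ∧ r i (m i) < r i y := by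
    intro x hx
    obtain ⟨i, hi⟩ := hy x
    have hmi : m i = x :=
      hr i (le_antisymm (hm i x hx) (hi _ (mem_insert_of_mem (hmV i))))
    have hlt : r i x < r i y :=
      lt_of_le_of_ne (hi y (mem_insert_self _ _)) fun h => hyV (hr i h ▸ hx)
    refine ⟨i, ?_, hmi, hmi ▸ hlt⟩
    rintro rfl
    exact hlt.not_ge (hj x (mem_insert_of_mem hx))
  have hsurj : ∀ x ∈ V, ∃ i, i ≠ j ∧ m i = x := fun x hx =>
    let ⟨i, h₁, h₂, _⟩ := hbelow x hx
    ⟨i, h₁, h₂⟩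
  have hrep : IsReplacement r m j y := by
    refine ⟨fun i hi => ?_, fun z hz => ?_⟩
    · obtain ⟨k, hk, hmk, hlt⟩ := hbelow (m i) (hmV i)
      obtain rfl := eq_of_surjOn_erase hcard hsurj hmV hk hi hmk
      exact hlt
    · obtain ⟨i, hi⟩ := hy z
      by_cases hij : i = j
      · subst hij
        exact hi y (mem_insert_self _ _)
      · exact absurd (hi _ (mem_insert_of_mem (hmV i))) (hz i hij).not_ge
  by_cases hja : a = j
  · exact .inl (hja ▸ hrep)
  by_cases hjb : b = j
  · exact .inr (hjb ▸ hrep)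
  exact absurd (eq_of_surjOn_erase hcard hsurj hmV hja hjb hmab) hab

/-- A door, that is, a dominant set one point short of a room, with `m` realizing its minima and
`m a = m b`, extends to rooms exactly by the replacements at `a` and at `b`. -/
theorem mem_rooms_above_iff [Fintype I] [DecidableEq X] (hr : ∀ i, Function.Injective (r i))
    (hV : IsDominant r V) (hcard : #V + 1 = Fintype.card I)
    (hmV : ∀ i, m i ∈ V) (hm : ∀ i, ∀ x ∈ V, r i (m i) ≤ r i x) {a b : I} (hab : a ≠ b)
    (hmab : m a = m b) (U : Finset X) :
    ((#U = Fintype.card I ∧ IsDominant r U) ∧ V ⊆ U) ↔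
      ∃ y, (IsReplacement r m a y ∨ IsReplacement r m b y) ∧ insert y V = U := by
  constructor
  · rintro ⟨⟨hU, hdom⟩, hVU⟩
    obtain ⟨y, hyV, rfl⟩ := (covBy_iff_exists_insert.1
      (covBy_iff_card_sdiff_eq_one.2 ⟨hVU, by rw [card_sdiff_of_subset hVU]; omega⟩))
    exact ⟨y, hdom.isReplacement_of_insert hr hcard hmV hm hab hmab hyV, rfl⟩
  · rintro ⟨y, hy, rfl⟩
    have hyV : y ∉ V := hy.elim (fun h => h.notMem hr hV hmV hm hab hmab)
      fun h => h.notMem hr hV hmV hm hab.symm hmab.symm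
    refine ⟨⟨by rw [card_insert_of_notMem hyV, hcard], ?_⟩, subset_insert _ _⟩
    exact hy.elim (fun h => h.isDominant_insert hV hmV hm) fun h => h.isDominant_insert hV hmV hm

end Dominant

/-- A set without all colours has an even number of facets coloured by all colours but one. -/
theorem even_card_facets {I X : Type*} [Fintype I] [DecidableEq I] [Fintype X] [DecidableEq X]
    (c : X → I) (i₀ : I) {U : Finset X} (hU : #U = Fintype.card I) (hfull : U.image c ≠ univ) :
    Even #{V : Finset X | (#V + 1 = Fintype.card I ∧ V.image c = univ.erase i₀) ∧ V ⊆ U} := by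
  have hinj : ∀ V : Finset X, #V + 1 = Fintype.card I → V.image c = univ.erase i₀ →
      Set.InjOn c V := by
    intro V h₁ h₂
    rw [← card_image_iff, h₂, card_erase_of_mem (mem_univ _), card_univ]
    omega
  have herase : ∀ V : Finset X, #V + 1 = Fintype.card I → V ⊆ U → ∃ x ∈ U, V = U.erase x := by
    intro V h₁ h₂
    obtain ⟨x, hx, rfl⟩ := (covBy_iff_exists_insert.1
      (covBy_iff_card_sdiff_eq_one.2 ⟨h₂, by rw [card_sdiff_of_subset h₂]; omega⟩))
    exact ⟨x, mem_insert_self _ _, (erase_insert hx).symm⟩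
  obtain hempty | ⟨V, hV⟩ := Finset.eq_empty_or_nonempty
    ({V : Finset X | (#V + 1 = Fintype.card I ∧ V.image c = univ.erase i₀) ∧ V ⊆ U} : Finset _)
  · simp [hempty]
  simp only [mem_filter, mem_univ, true_and] at hV
  obtain ⟨⟨hVcard, hVc⟩, hVU⟩ := hV
  obtain ⟨x, hxU, rfl⟩ := herase V hVcard hVU
  have hx₀ : c x ≠ i₀ := by
    intro h
    apply hfull
    rw [← insert_erase hxU, image_insert, hVc, h, insert_erase (mem_univ _)]
  obtain ⟨y, hy, hxy⟩ : ∃ y ∈ U.erase x, c y = c x := by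
    rw [← mem_image, hVc]
    simpa using hx₀
  obtain ⟨hyx, hyU⟩ := mem_erase.1 hy
  have hset : ({V : Finset X | (#V + 1 = Fintype.card I ∧ V.image c = univ.erase i₀) ∧ V ⊆ U} :
      Finset _) = {U.erase x, U.erase y} := by
    ext W
    simp only [mem_filter, mem_univ, true_and, mem_insert, mem_singleton]
    constructor
    · rintro ⟨⟨h₁, h₂⟩, h₃⟩
      obtain ⟨w, -, rfl⟩ := herase W h₁ h₃
      by_contra! hne
      have hwx : x ≠ w := fun h => hne.1 (h ▸ rfl)
      have hwy : y ≠ w := fun h => hne.2 (h ▸ rfl)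
      exact hyx (hinj _ h₁ h₂ (mem_erase.2 ⟨hwy, hyU⟩) (mem_erase.2 ⟨hwx, hxU⟩) hxy)
    · rintro (rfl | rfl)
      · exact ⟨⟨hVcard, hVc⟩, hVU⟩
      · refine ⟨⟨by rw [← hVcard, card_erase_of_mem hxU, card_erase_of_mem hyU], ?_⟩,
          erase_subset _ _⟩
        rw [← hVc]
        ext i
        simp only [mem_image, mem_erase]
        constructor
        · rintro ⟨z, ⟨hzy, hzU⟩, rfl⟩
          by_cases hzx : z = x
          · exact ⟨y, ⟨hyx, hyU⟩, hzx ▸ hxy⟩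
          · exact ⟨z, ⟨hzx, hzU⟩, rfl⟩
        · rintro ⟨z, ⟨hzx, hzU⟩, rfl⟩
          by_cases hzy : z = y
          · exact ⟨x, ⟨hyx.symm, hxU⟩, hzy ▸ hxy.symm⟩
          · exact ⟨z, ⟨hzy, hzU⟩, rfl⟩
  rw [hset, card_pair]
  · exact even_two
  · intro h
    have : y ∈ U.erase y := h ▸ hy
    simp at this

/-- Scarf's lemma: if `s i` is the lowest point of the ranking `r i` and lies above every
non-slack point in the other rankings, then every colouring with `c (s i) = i` admits a dominant
set carrying each colour once. -/
theorem exists_isDominant_image_eq_univ {I X α : Type*} [Fintype I] [DecidableEq I] [Nontrivial I]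
    [Fintype X] [DecidableEq X] [LinearOrder α] {r : I → X → α}
    (hr : ∀ i, Function.Injective (r i)) (s : I → X)
    (hmin : ∀ i x, x ≠ s i → r i (s i) < r i x)
    (hmax : ∀ i j x, j ≠ i → x ∉ Set.range s → r i x < r i (s j))
    (c : X → I) (hc : ∀ i, c (s i) = i) :
    ∃ U : Finset X, #U = Fintype.card I ∧ IsDominant r U ∧ U.image c = univ := by
  classical
  by_contra! hno
  obtain ⟨i₀⟩ : Nonempty I := inferInstance
  have hs : Function.Injective s := fun i j h => by rw [← hc i, h, hc]
  have hI : 1 < Fintype.card I := Fintype.one_lt_card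
  set rooms : Finset (Finset X) := {U | #U = Fintype.card I ∧ IsDominant r U} with hrooms
  set doors : Finset (Finset X) :=
    {V | (#V + 1 = Fintype.card I ∧ V.image c = univ.erase i₀) ∧ IsDominant r V} with hdoors
  set V₀ : Finset X := (univ.erase i₀).image s with hV₀
  have hdouble := sum_card_bipartiteAbove_eq_sum_card_bipartiteBelow
    (s := doors) (t := rooms) (fun V U => V ⊆ U)
  have heven : Even (∑ U ∈ rooms, #(bipartiteBelow (fun V U => V ⊆ U) doors U)) := by
    refine even_sum _ fun U hU => ?_
    simp only [hrooms, mem_filter, mem_univ, true_and] at hU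
    refine (congrArg (fun F => Even #F) ?_).mpr (even_card_facets c i₀ hU.1 (hno U hU.1 hU.2))
    ext V
    simp only [bipartiteBelow, hdoors, mem_filter, mem_univ, true_and]
    constructor
    · rintro ⟨⟨h₁, -⟩, h₂⟩
      exact ⟨h₁, h₂⟩
    · rintro ⟨h₁, h₂⟩
      refine ⟨⟨h₁, fun y => ?_⟩, h₂⟩
      obtain ⟨i, hi⟩ := hU.2 y
      exact ⟨i, fun x hx => hi x (h₂ hx)⟩
  have hargmin : ∀ V ∈ doors, ∃ m : I → X, (∀ i, m i ∈ V) ∧ ∀ i, ∀ x ∈ V, r i (m i) ≤ r i x := by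
    intro V hV
    simp only [hdoors, mem_filter, mem_univ, true_and] at hV
    have hne : V.Nonempty := card_pos.1 (by omega)
    choose m h₁ h₂ using fun i => V.exists_min_image (r i) hne
    exact ⟨m, h₁, h₂⟩
  have hV₀mem : V₀ ∈ doors := by
    simp only [hdoors, mem_filter, mem_univ, true_and]
    refine ⟨⟨?_, ?_⟩, fun y => ?_⟩
    · rw [hV₀, card_image_of_injective _ hs, card_erase_of_mem (mem_univ _), card_univ]
      omega
    · rw [hV₀, image_image]
      rw [show c ∘ s = id from funext hc, image_id]
    · by_cases hy : y ∈ Set.range s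
      · obtain ⟨i, rfl⟩ := hy
        refine ⟨i, fun x _ => ?_⟩
        by_cases hx : x = s i
        · rw [hx]
        · exact (hmin i x hx).le
      · refine ⟨i₀, fun x hx => ?_⟩
        obtain ⟨j, hj, rfl⟩ := mem_image.1 hx
        exact (hmax i₀ j y (ne_of_mem_erase hj) hy).le
  have hother : ∀ V ∈ doors.erase V₀, Even #(bipartiteAbove (fun V U => V ⊆ U) rooms V) := by
    intro V hV
    obtain ⟨hne, hV⟩ := mem_erase.1 hV
    obtain ⟨m, hmV, hm⟩ := hargmin V hV
    simp only [hdoors, mem_filter, mem_univ, true_and] at hV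
    obtain ⟨⟨hcard, hVc⟩, hdom⟩ := hV
    obtain ⟨t, htV, ht⟩ : ∃ t ∈ V, t ∉ Set.range s := by
      by_contra! h
      refine hne (eq_of_subset_of_card_le (fun x hx => ?_) ?_)
      · obtain ⟨i, rfl⟩ := h x hx
        have := mem_image_of_mem c hx
        rw [hVc, hc] at this
        exact mem_image_of_mem s this
      · rw [hV₀, card_image_of_injective _ hs, card_erase_of_mem (mem_univ _), card_univ]
        omega
    obtain ⟨a, -, b, -, hab, hmab⟩ := exists_ne_map_eq_of_card_lt_of_maps_to
      (s := (univ : Finset I)) (t := V) (by rw [card_univ]; omega) (f := m) fun i _ => hmV i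
    have hex : ∀ j, ∃ y, IsReplacement r m j y := fun j =>
      exists_isReplacement (y := s j) fun i hi =>
        (hm i t htV).trans_lt (hmax i j t hi.symm ht)
    obtain ⟨y, hy⟩ := hex a
    obtain ⟨z, hz⟩ := hex b
    have hyV := hy.notMem hr hdom hmV hm hab hmab
    have hyz : y ≠ z := by
      rintro rfl
      obtain ⟨i, hi⟩ := hdom y
      by_cases hia : i = a
      · exact (hz.1 i (hia ▸ hab)).not_ge (hi _ (hmV i))
      · exact (hy.1 i hia).not_ge (hi _ (hmV i))
    have hset : bipartiteAbove (fun V U => V ⊆ U) rooms V = {insert y V, insert z V} := by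
      ext U
      simp only [bipartiteAbove, hrooms, mem_filter, mem_univ, true_and, mem_insert,
        mem_singleton]
      rw [mem_rooms_above_iff hr hdom hcard hmV hm hab hmab]
      constructor
      · rintro ⟨w, hw | hw, rfl⟩
        · exact .inl (by rw [hw.unique hr hy])
        · exact .inr (by rw [hw.unique hr hz])
      · rintro (rfl | rfl)
        · exact ⟨y, .inl hy, rfl⟩
        · exact ⟨z, .inr hz, rfl⟩
    rw [hset, card_pair]
    · exact even_two
    · intro h
      have : y ∈ insert z V := h ▸ mem_insert_self y V
      exact (mem_insert.1 this).elim hyz hyV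
  have hone : #(bipartiteAbove (fun V U => V ⊆ U) rooms V₀) = 1 := by
    obtain ⟨m, hmV, hm⟩ := hargmin V₀ hV₀mem
    simp only [hdoors, mem_filter, mem_univ, true_and] at hV₀mem
    obtain ⟨⟨hcard, -⟩, hdom⟩ := hV₀mem
    have hms : ∀ i, i ≠ i₀ → m i = s i := by
      intro i hi
      by_contra hne
      exact (hmin i _ hne).not_ge (hm i _ (mem_image_of_mem s (by simpa using hi)))
    obtain ⟨l, hl, hml⟩ := mem_image.1 (hmV i₀)
    have hl₀ : l ≠ i₀ := ne_of_mem_erase hl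
    obtain ⟨y, hy⟩ : ∃ y, IsReplacement r m i₀ y :=
      exists_isReplacement (y := s i₀) fun i hi => by
        rw [hms i hi]
        exact hmin i _ (hs.ne hi.symm)
    have hnone : ∀ z, ¬ IsReplacement r m l z := by
      intro z hz
      have h₀ := hz.1 i₀ hl₀.symm
      rw [← hml] at h₀
      by_cases hzs : z ∈ Set.range s
      · obtain ⟨k, rfl⟩ := hzs
        by_cases hkl : k = l
        · exact lt_irrefl _ (hkl ▸ h₀)
        by_cases hk₀ : k = i₀
        · subst hk₀
          exact lt_asymm h₀ (hmin k _ (hs.ne hl₀))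
        · have := hz.1 k hkl
          rw [hms k hk₀] at this
          exact lt_irrefl _ this
      · exact lt_asymm h₀ (hmax i₀ l z hl₀ hzs)
    rw [card_eq_one]
    refine ⟨insert y V₀, ?_⟩
    ext U
    simp only [bipartiteAbove, hrooms, mem_filter, mem_univ, true_and, mem_singleton]
    rw [mem_rooms_above_iff hr hdom hcard hmV hm hl₀.symm (by rw [← hml, hms l hl₀])]
    constructor
    · rintro ⟨w, hw | hw, rfl⟩
      · rw [hw.unique hr hy]
      · exact absurd hw (hnone w)
    · rintro rfl
      exact ⟨y, .inl hy, rfl⟩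
  rw [← hdouble, ← add_sum_erase _ _ hV₀mem, hone] at heven
  have := even_sum _ hother
  rw [Nat.even_add] at heven
  exact absurd (heven.2 this) (by decide)

/-- For every colouring of the grid of vectors of natural numbers with sum `n`, some grid point has,
for each `i`, a small `i`-th coordinate or a nearby grid point of colour `i`. -/
theorem exists_grid_point {S : Type*} [Fintype S] [DecidableEq S] [Nontrivial S] (n : ℕ)
    (c : (S → ℕ) → S) :
    ∃ k : S → ℕ, ∑ i, k i = n ∧ ∀ i, k i ≤ Fintype.card S ∨
      ∃ l : S → ℕ, ∑ i, l i = n ∧ c l = i ∧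
        ∀ j, k j ≤ l j + Fintype.card S ∧ l j ≤ k j + Fintype.card S := by
  classical
  let T := {k : S → ℕ // k ∈ piAntidiag (univ : Finset S) n}
  have hT : ∀ t : T, ∑ i, t.1 i = n := fun t => (mem_piAntidiag.1 t.2).1
  have hTle : ∀ (t : T) i, t.1 i ≤ n := fun t i =>
    (single_le_sum (fun _ _ => Nat.zero_le _) (mem_univ i)).trans (hT t).le
  let e := Fintype.equivFin (T ⊕ S)
  let h : S → T ⊕ S → ℕ := fun i =>
    Sum.elim (fun t => t.1 i + 1) fun j => if j = i then 0 else n + 2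
  let r : S → T ⊕ S → ℕ ×ₗ Fin (Fintype.card (T ⊕ S)) := fun i x => toLex (h i x, e x)
  have hlt : ∀ i x y, h i x < h i y → r i x < r i y := fun i x y hxy =>
    Prod.Lex.toLex_lt_toLex.2 (.inl hxy)
  have hle : ∀ i x y, r i x ≤ r i y → h i x ≤ h i y := fun i x y hxy =>
    not_lt.1 fun hh => (hlt i y x hh).not_ge hxy
  obtain ⟨U, hU, hdom, himg⟩ := exists_isDominant_image_eq_univ (r := r)
    (fun i x y hxy => e.injective (congrArg (fun p => (ofLex p).2) hxy)) Sum.inr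
    (by
      rintro i (t | j) hx
      · exact hlt _ _ _ (by simp [h])
      · have hj : j ≠ i := fun hh => hx (hh ▸ rfl)
        exact hlt _ _ _ (by simp [h, hj]))
    (by
      rintro i j (t | j') hj hx
      · refine hlt _ _ _ ?_
        have := hTle t i
        simp only [h, Sum.elim_inl, Sum.elim_inr, if_neg hj]
        omega
      · exact absurd ⟨j', rfl⟩ hx)
    (Sum.elim (fun t => c t.1) id) fun _ => rfl
  have hinj : Set.InjOn (Sum.elim (fun t : T => c t.1) id) (U : Set (T ⊕ S)) := by
    rw [← card_image_iff, himg, hU, card_univ]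
  have hcolor : ∀ i, Sum.inr i ∈ U ∨ ∃ t : T, Sum.inl t ∈ U ∧ c t.1 = i := by
    intro i
    obtain ⟨t | j, hx, hxi⟩ := mem_image.1 (himg.symm ▸ mem_univ i)
    · exact .inr ⟨t, hx, hxi⟩
    · exact .inl ((show j = i from hxi) ▸ hx)
  have hmin : ∀ i, ∃ a, (Sum.inr i ∉ U → ∃ t : T, Sum.inl t ∈ U ∧ t.1 i = a) ∧
      (∀ t : T, Sum.inl t ∈ U → Sum.inr i ∉ U → a ≤ t.1 i) := by
    intro i
    by_cases hi : Sum.inr i ∈ U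
    · exact ⟨0, fun h' => absurd hi h', fun _ _ h' => absurd hi h'⟩
    · obtain ⟨t, ht, -⟩ := (hcolor i).resolve_left hi
      obtain ⟨t', ht', hmin⟩ := (univ.filter fun t : T => Sum.inl t ∈ U).exists_min_image
        (fun t => t.1 i) ⟨t, by simpa using ht⟩
      exact ⟨t'.1 i, fun _ => ⟨t', by simpa using ht', rfl⟩,
        fun w hw _ => hmin w (by simpa using hw)⟩
  choose a ha₁ ha₂ using hmin
  let C : Finset S := univ.filter fun i => Sum.inr i ∉ U
  have hmemC : ∀ i, i ∈ C ↔ Sum.inr i ∉ U := fun i => by simp [C]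
  have hpos : ∀ t : T, ∃ i ∈ C, t.1 i ≤ a i := by
    intro t
    obtain ⟨i, hi⟩ := hdom (Sum.inl t)
    have hiU : Sum.inr i ∉ U := fun hU' => by
      have := hle _ _ _ (hi _ hU')
      simp [h] at this
    obtain ⟨t', ht', hta⟩ := ha₁ i hiU
    have := hle _ _ _ (hi _ ht')
    simp only [h, Sum.elim_inl] at this
    exact ⟨i, (hmemC i).2 hiU, by omega⟩
  obtain ⟨i₁⟩ : Nonempty S := inferInstance
  have hTn : ∀ k : S → ℕ, ∑ i, k i = n → k ∈ piAntidiag (univ : Finset S) n := fun k hk =>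
    mem_piAntidiag.2 ⟨hk, fun i _ => mem_univ i⟩
  obtain ⟨i₂, hi₂, -⟩ := hpos ⟨Pi.single i₁ n, hTn _ (by simp)⟩
  have hsum : n < ∑ i ∈ C, (a i + 1) := by
    by_contra! hle'
    let k : S → ℕ := fun i => (if i ∈ C then a i + 1 else 0) +
      if i = i₂ then n - ∑ i ∈ C, (a i + 1) else 0
    have hk : ∑ i, k i = n := by
      simp only [k, sum_add_distrib, sum_ite_mem, univ_inter, sum_ite_eq', mem_univ, if_true]
      rw [← sum_add_distrib]
      omega
    obtain ⟨i, hi, hki⟩ := hpos ⟨k, hTn k hk⟩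
    simp only [k, if_pos hi] at hki
    omega
  have hsum' : n ≤ ∑ i ∈ C, a i + Fintype.card S := by
    rw [sum_add_distrib, sum_const, smul_eq_mul, mul_one] at hsum
    have := card_le_univ C
    omega
  have hbound : ∀ t : T, Sum.inl t ∈ U → (∀ i ∈ C, t.1 i ≤ a i + Fintype.card S) ∧
      ∀ i ∉ C, t.1 i ≤ Fintype.card S := by
    intro t ht
    have h₁ : ∀ i ∈ C, a i ≤ t.1 i := fun i hi => ha₂ i t ht ((hmemC i).1 hi)
    have h₂ : ∑ i ∈ C, t.1 i + ∑ i ∈ Cᶜ, t.1 i = n := by rw [sum_add_sum_compl, hT]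
    refine ⟨fun i hi => ?_, fun i hi => ?_⟩
    · have h₃ := sum_le_sum fun j (hj : j ∈ C.erase i) => h₁ j (mem_of_mem_erase hj)
      have h₄ := add_sum_erase C a hi
      have h₅ := add_sum_erase C t.1 hi
      omega
    · have h₃ := sum_le_sum h₁
      have h₄ := single_le_sum (f := t.1) (fun _ _ => Nat.zero_le _) (mem_compl.2 hi)
      omega
  obtain ⟨t, ht, -⟩ := (hcolor i₂).resolve_left ((hmemC i₂).1 hi₂)
  refine ⟨t.1, hT t, fun i => ?_⟩
  by_cases hi : i ∈ C
  · obtain ⟨t', ht', hc⟩ := (hcolor i).resolve_left ((hmemC i).1 hi)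
    refine .inr ⟨t'.1, hT t', hc, fun j => ?_⟩
    have b := hbound t ht
    have b' := hbound t' ht'
    by_cases hj : j ∈ C
    · have := b.1 j hj
      have := b'.1 j hj
      have := ha₂ j t ht ((hmemC j).1 hj)
      have := ha₂ j t' ht' ((hmemC j).1 hj)
      omega
    · have := b.2 j hj
      have := b'.2 j hj
      omega
  · exact .inl ((hbound t ht).2 i hi)

theorem exists_forall_nonneg_of_continuous {S : Type*} [Fintype S] [Nontrivial S]
    (g : S → (S → ℝ) → ℝ) (hg : ∀ i, Continuous (g i)) (hface : ∀ i x, x i = 0 → 0 ≤ g i x)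
    (hex : ∀ x ∈ simplex S, ∃ i, 0 ≤ g i x) : ∃ x ∈ simplex S, ∀ i, 0 ≤ g i x := by
  classical
  have happrox : ∀ n : ℕ, ∃ x ∈ simplex S, ∀ i, ∃ z, dist z x ≤ Fintype.card S / ((n : ℝ) + 1) ∧
      0 ≤ g i z := by
    intro n
    have hn : (0 : ℝ) < n + 1 := by positivity
    let p : (S → ℕ) → S → ℝ := fun k i => k i / ((n : ℝ) + 1)
    have hp : ∀ k : S → ℕ, ∑ i, k i = n + 1 → p k ∈ simplex S := by
      refine fun k hk => ⟨fun i => by positivity, ?_⟩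
      rw [← sum_div, div_eq_one_iff_eq hn.ne']
      exact_mod_cast hk
    have hc : ∀ k : S → ℕ, ∃ i, ∑ i, k i = n + 1 → 0 ≤ g i (p k) := by
      intro k
      by_cases hk : ∑ i, k i = n + 1
      · exact (hex _ (hp k hk)).imp fun i hi _ => hi
      · exact ⟨Classical.arbitrary S, fun h => absurd h hk⟩
    choose c hc using hc
    obtain ⟨k, hk, hkl⟩ := exists_grid_point (n + 1) c
    refine ⟨p k, hp k hk, fun i => ?_⟩
    rcases hkl i with hi | ⟨l, hl, rfl, hdist⟩
    · refine ⟨Function.update (p k) i 0, ?_, hface i _ (Function.update_self ..)⟩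
      refine (dist_pi_le_iff (by positivity)).2 fun j => ?_
      by_cases hj : j = i
      · subst hj
        rw [Function.update_self, dist_zero_left, Real.norm_of_nonneg (by positivity)]
        have : (k j : ℝ) ≤ Fintype.card S := by exact_mod_cast hi
        exact div_le_div_of_nonneg_right this hn.le
      · rw [Function.update_of_ne hj, dist_self]
        positivity
    · refine ⟨p l, ?_, hc l hl⟩
      refine (dist_pi_le_iff (by positivity)).2 fun j => ?_
      rw [Real.dist_eq, ← sub_div, abs_div, abs_of_pos hn]
      refine div_le_div_of_nonneg_right (abs_sub_le_iff.2 ?_) hn.le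
      have h₁ : (k j : ℝ) ≤ l j + Fintype.card S := by exact_mod_cast (hdist j).1
      have h₂ : (l j : ℝ) ≤ k j + Fintype.card S := by exact_mod_cast (hdist j).2
      constructor <;> linarith
  choose x hx z hz hgz using happrox
  have hcompact : IsCompact (simplex S) := isCompact_stdSimplex ℝ S
  obtain ⟨y, hy, φ, hφ, hlim⟩ := hcompact.tendsto_subseq hx
  refine ⟨y, hy, fun i => ?_⟩
  have hzero : Filter.Tendsto (fun n : ℕ => (Fintype.card S : ℝ) / ((n : ℝ) + 1)) Filter.atTop
      (nhds 0) := by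
    simpa [Function.comp_def] using
      (tendsto_const_div_atTop_nhds_zero_nat (Fintype.card S : ℝ)).comp
        (Filter.tendsto_add_atTop_nat 1)
  have hdist : Filter.Tendsto (fun n => dist (x (φ n)) (z (φ n) i)) Filter.atTop (nhds 0) :=
    squeeze_zero (fun _ => dist_nonneg) (fun n => (dist_comm _ _).trans_le (hz (φ n) i))
      (hzero.comp hφ.tendsto_atTop)
  have hzlim : Filter.Tendsto (fun n => z (φ n) i) Filter.atTop (nhds y) :=
    (tendsto_iff_of_dist hdist).1 hlim
  exact ge_of_tendsto' (((hg i).tendsto y).comp hzlim) fun n => hgz (φ n) i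

theorem mem_convexHull_pointMass_support {S : Type*} [Fintype S] [DecidableEq S] {x : S → ℝ}
    (hx : x ∈ simplex S) :
    x ∈ convexHull ℝ (pointMass '' ((univ.filter fun s => x s ≠ 0 : Finset S) : Set S)) := by
  have hsum : ∑ s with x s ≠ 0, x s = 1 := by rw [sum_filter_ne_zero, hx.2]
  have hcomb : ∑ s with x s ≠ 0, x s • pointMass s = x := by
    rw [sum_filter_of_ne (p := fun s => x s ≠ 0) fun s _ h hs => h (by rw [hs, zero_smul])]
    ext j
    simp [pointMass, Finset.sum_apply]
  have hmem := (convex_convexHull ℝ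
    (pointMass '' ((univ.filter fun s => x s ≠ 0 : Finset S) : Set S))).sum_mem
    (fun s _ => hx.1 s) hsum fun s hs => subset_convexHull ℝ _ ⟨s, by simpa using hs, rfl⟩
  rwa [hcomb] at hmem

/-- Knaster–Kuratowski–Mazurkiewicz: a KKM covering of the simplex by closed sets
has a common point. -/
theorem stmt_8 {S : Type*} [Fintype S] [DecidableEq S] [Nonempty S]
    (A : S → Set (S → ℝ))
    (hclosed : ∀ s, IsClosed (A s))
    (hsub : ∀ s, A s ⊆ simplex S)
    (hKKM : ∀ N : Finset S, N.Nonempty →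
      convexHull ℝ (pointMass '' (N : Set S)) ⊆ ⋃ s ∈ N, A s) :
    (⋂ s, A s).Nonempty := by
  have hvertex : ∀ s, pointMass s ∈ A s := fun s => by
    simpa using hKKM {s} (singleton_nonempty s) (subset_convexHull ℝ _ ⟨s, by simp, rfl⟩)
  rcases subsingleton_or_nontrivial S with hS | hS
  · obtain ⟨s⟩ : Nonempty S := inferInstance
    exact ⟨pointMass s, Set.mem_iInter.2 fun t => Subsingleton.elim s t ▸ hvertex s⟩
  have hmem : ∀ s x, Metric.infDist x (A s) = 0 ↔ x ∈ A s := fun s x =>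
    ((hclosed s).mem_iff_infDist_zero ⟨_, hvertex s⟩).symm
  let D : (S → ℝ) → ℝ := fun x => ∑ s, Metric.infDist x (A s)
  have hD : Continuous D := continuous_finsetSum _ fun s _ => Metric.continuous_infDist_pt _
  let g : S → (S → ℝ) → ℝ := fun s x => Metric.infDist x (A s) - x s * D x
  have hgsum : ∀ x ∈ simplex S, ∑ s, g s x = 0 := fun x hx => by
    simp only [g, sum_sub_distrib, ← sum_mul, hx.2, one_mul, D, sub_self]
  obtain ⟨x, hx, hgx⟩ := exists_forall_nonneg_of_continuous g
    (fun s => (Metric.continuous_infDist_pt _).sub ((continuous_apply s).mul hD))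
    (fun s x hs => by simpa [g, hs] using Metric.infDist_nonneg)
    (fun x hx => by
      by_contra! hneg
      exact (sum_neg (fun s _ => hneg s) univ_nonempty).ne (hgsum x hx))
  have hg0 : ∀ s, g s x = 0 := fun s =>
    (sum_eq_zero_iff_of_nonneg fun s _ => hgx s).1 (hgsum x hx) s (mem_univ s)
  have hne : (univ.filter fun s => x s ≠ 0).Nonempty := by
    obtain ⟨s, -, hs⟩ := exists_ne_zero_of_sum_ne_zero (hx.2.trans_ne one_ne_zero)
    exact ⟨s, by simpa using hs⟩
  obtain ⟨s, hs, hxs⟩ : ∃ s, x s ≠ 0 ∧ x ∈ A s := by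
    simpa using hKKM _ hne (mem_convexHull_pointMass_support hx)
  have hDx : D x = 0 := by
    have := hg0 s
    simp only [g, (hmem s x).2 hxs, zero_sub, neg_eq_zero, mul_eq_zero] at this
    exact this.resolve_left hs
  refine ⟨x, Set.mem_iInter.2 fun t => (hmem t x).1 ?_⟩
  have := hg0 t
  simpa [g, hDx] using this
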